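/- Frustration Free Entropy Bound: let n be a nonempty finite type and let H, ρ : Matrix n n ℂ be positive semidefinite matrices with ρ.trace = 1 and (ρ * H).trace = 0 (ρ is a ground state of the frustration-free Hamiltonian H, whose ground state energy is 0). Let λ : n → ℝ be the eigenvalues of ρ given by Matrix.IsHermitian.eigenvalues applied to the Hermitian property of ρ. Then the von Neumann entropy of ρ satisfies ∑_i Real.negMulLog (λ i) ≤ Real.log (Fintype.card n − H.rank), i.e. S(ρ) ≤ log G(H), where G(H) = dim ker H = (Fintype.card n) − H.rank is the ground state degeneracy of H. -/

import Mathlib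

open scoped ComplexOrder

open scoped BigOperators

/-- The Shannon entropy of a probability vector with at most `k` nonzero entries is at most
`log k`. -/
theorem Real.sum_negMulLog_le_log_of_card_support_le {ι : Type*} [Fintype ι] {p : ι → ℝ}
    (hp : ∀ i, 0 ≤ p i) (hsum : ∑ i, p i = 1) {k : ℝ}
    (hk : (Fintype.card {i // p i ≠ 0} : ℝ) ≤ k) :
    ∑ i, Real.negMulLog (p i) ≤ Real.log k := by
  classical
  rw [Fintype.card_subtype] at hk
  set s : Finset ι := Finset.univ.filter fun i => p i ≠ 0 with hs
  have hsub (f : ℝ → ℝ) (hf : f 0 = 0) : ∑ i, f (p i) = ∑ i ∈ s, f (p i) := by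
    refine (Finset.sum_subset s.subset_univ fun i _ hi => ?_).symm
    rw [show p i = 0 by simpa [hs] using hi, hf]
  have hsum' : ∑ i ∈ s, p i = 1 := (hsub id rfl).symm.trans hsum
  have hs_pos : 0 < s.card := by
    rw [Finset.card_pos, Finset.nonempty_iff_ne_empty]
    intro h
    simp [h] at hsum'
  have hk_pos : 0 < k := lt_of_lt_of_le (by exact_mod_cast hs_pos) hk
  have hterm (i : ι) : Real.negMulLog (p i) ≤ p i * Real.log k + (1 / k - p i) := by
    have h := Real.negMulLog_le_one_sub_self (mul_nonneg (hp i) hk_pos.le)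
    rw [Real.negMulLog_mul, show Real.negMulLog k = -k * Real.log k from rfl] at h
    refine le_of_mul_le_mul_left ?_ hk_pos
    have hk_inv : k * (1 / k) = 1 := by field_simp
    linear_combination h - hk_inv
  calc ∑ i, Real.negMulLog (p i) = ∑ i ∈ s, Real.negMulLog (p i) :=
        hsub _ Real.negMulLog_zero
    _ ≤ ∑ i ∈ s, (p i * Real.log k + (1 / k - p i)) := Finset.sum_le_sum fun i _ => hterm i
    _ = Real.log k + (s.card / k - 1) := by
        rw [Finset.sum_add_distrib, Finset.sum_sub_distrib, ← Finset.sum_mul, hsum']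
        simp [div_eq_mul_inv]
    _ ≤ Real.log k := by linarith [(div_le_one hk_pos).2 hk]

open scoped MatrixOrder in
/-- Positive semidefinite matrices that are orthogonal for the trace pairing multiply to zero. -/
theorem Matrix.PosSemidef.mul_eq_zero_of_trace_mul_eq_zero {n : Type*} [Fintype n]
    {A B : Matrix n n ℂ} (hA : A.PosSemidef) (hB : B.PosSemidef) (h : (A * B).trace = 0) :
    A * B = 0 := by
  classical
  obtain ⟨a, rfl⟩ := CStarAlgebra.nonneg_iff_eq_star_mul_self.mp hA.nonneg
  obtain ⟨b, rfl⟩ := CStarAlgebra.nonneg_iff_eq_star_mul_self.mp hB.nonneg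
  simp only [Matrix.star_eq_conjTranspose] at h ⊢
  have hab : a * b.conjTranspose = 0 := by
    rw [← Matrix.trace_conjTranspose_mul_self_eq_zero_iff, Matrix.conjTranspose_mul,
      Matrix.conjTranspose_conjTranspose, Matrix.mul_assoc, Matrix.trace_mul_comm]
    rwa [← Matrix.mul_assoc, Matrix.mul_assoc] at h ⊢
  rw [Matrix.mul_conjTranspose_mul_self_eq_zero, Matrix.mul_assoc, hab, Matrix.mul_zero]

/-- Frustration Free Entropy Bound: a ground state `ρ` of a PSD Hamiltonian `H`
(with ground state energy 0) has von Neumann entropy at most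
`log G(H)` where `G(H) = card n - rank H` is the ground state degeneracy. -/
theorem frustration_free_entropy_bound
    {n : Type*} [Fintype n] [DecidableEq n] [Nonempty n]
    (H ρ : Matrix n n ℂ)
    (hH : H.PosSemidef) (hρ : ρ.PosSemidef)
    (hρtr : ρ.trace = 1) (hground : (ρ * H).trace = 0) :
    ∑ i, Real.negMulLog (hρ.isHermitian.eigenvalues i)
      ≤ Real.log ((Fintype.card n : ℝ) - (H.rank : ℝ)) := by
  refine Real.sum_negMulLog_le_log_of_card_support_le hρ.eigenvalues_nonneg ?_ ?_
  · have h : ∑ i, (hρ.isHermitian.eigenvalues i : ℂ) = 1 :=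
      hρ.isHermitian.trace_eq_sum_eigenvalues.symm.trans hρtr
    exact_mod_cast h
  · rw [← hρ.isHermitian.rank_eq_card_non_zero_eigs, le_sub_iff_add_le]
    exact_mod_cast Matrix.rank_add_rank_le_card_of_mul_eq_zero
      (hρ.mul_eq_zero_of_trace_mul_eq_zero hH hground)
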